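/- Let π be a ∗-representation of X on a complex Hilbert space H and let φ be a unit vector in ker(π(y₀) − α^{-1}·I). Define c₀ = 1 and c_𝔫 = (n₁!⋯n_d!)^{-1/2}(1+α)(2+α)⋯(|𝔫|+α) for 𝔫 ∈ ℕ^d, 𝔫 ≠ 0. Then there exists an isometry V : ℓ²(ℕ^d) → H such that V e_𝔫 = c_𝔫 π((x^𝔫)*)φ for all 𝔫 ∈ ℕ^d, and V ∘ T = π(T) ∘ V for every T ∈ X (where T acts on ℓ²(ℕ^d) as itself). In particular, the restriction of π to the range of V is unitarily equivalent to the identity representation of X. -/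

import Mathlib

noncomputable section

/-- The Hilbert space `ℓ²(ℕ^d)`. -/
abbrev L2 (d : ℕ) := lp (fun _ : Fin d → ℕ => ℂ) 2

/-- Bounded operators on `ℓ²(ℕ^d)`. -/
abbrev BdOp (d : ℕ) := L2 d →L[ℂ] L2 d

/-- The standard basis vector `e_𝔫` of `ℓ²(ℕ^d)`. -/
def e2 (d : ℕ) (n : Fin d → ℕ) : L2 d := lp.single 2 n (1 : ℂ)

/-- The total degree `|𝔫| = n₁ + ⋯ + n_d`. -/
def degIdx (d : ℕ) (n : Fin d → ℕ) : ℕ := ∑ k, n k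

/-- The multi-index resulting from applying `a_k` (`k > 0`: annihilation at
slot `k`, `k < 0`: creation at slot `−k`, `k = 0` or `|k| > d`: identity)
to the basis vector `e_𝔫`. -/
def aIdx (d : ℕ) (k : ℤ) (n : Fin d → ℕ) : Fin d → ℕ :=
  if h : 0 < k ∧ k ≤ (d : ℤ) then
    Function.update n ⟨(k - 1).toNat, by omega⟩ (n ⟨(k - 1).toNat, by omega⟩ - 1)
  else if h' : 0 < -k ∧ -k ≤ (d : ℤ) then
    Function.update n ⟨(-k - 1).toNat, by omega⟩ (n ⟨(-k - 1).toNat, by omega⟩ + 1)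
  else n

/-- The coefficient of `a_k e_𝔫`: `√(n_k)` for `k > 0`, `√(n_{−k}+1)` for
`k < 0`, and `1` for `k = 0`, so that `a_k e_𝔫 = (aCoef k 𝔫) • e_{aIdx k 𝔫}`. -/
def aCoef (d : ℕ) (k : ℤ) (n : Fin d → ℕ) : ℝ :=
  if h : 0 < k ∧ k ≤ (d : ℤ) then Real.sqrt (n ⟨(k - 1).toNat, by omega⟩)
  else if h' : 0 < -k ∧ -k ≤ (d : ℤ) then Real.sqrt (n ⟨(-k - 1).toNat, by omega⟩ + 1)
  else 1

/-- The multi-index of `x_{kl} e_𝔫`. -/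
def xIdx (d : ℕ) (k l : ℤ) (n : Fin d → ℕ) : Fin d → ℕ := aIdx d k (aIdx d l n)

/-- The coefficient of `x_{kl} e_𝔫`, where `x_{kl} = a_k a_l (N+α)⁻¹` if
`k ≥ 0` or `l ≥ 0`, and `x_{kl} = (N+α)⁻¹ a_k a_l` if `k < 0` and `l < 0`. -/
def xCoef (d : ℕ) (α : ℝ) (k l : ℤ) (n : Fin d → ℕ) : ℝ :=
  if 0 ≤ k ∨ 0 ≤ l then aCoef d k (aIdx d l n) * aCoef d l n / (degIdx d n + α)
  else aCoef d k (aIdx d l n) * aCoef d l n / (degIdx d (xIdx d k l n) + α)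

/-- The eigenvalue of `y_m = (N + α + m)⁻¹` on `e_𝔫`. -/
def yCoef (d : ℕ) (α : ℝ) (m : ℤ) (n : Fin d → ℕ) : ℝ :=
  ((degIdx d n : ℝ) + α + m)⁻¹

/-- `xop`, `yop` implement the operators `x_{kl}` and `y_n` of Section 3:
each `x_{kl}` (for `|k|, |l| ≤ d`) acts on basis vectors as the continuous
extension of `a_k a_l (N+α)⁻¹` resp. `(N+α)⁻¹ a_k a_l`, and each `y_m` acts
diagonally with eigenvalue `(|𝔫|+α+m)⁻¹`. -/
def IsXYSystem (d : ℕ) (α : ℝ) (xop : ℤ → ℤ → BdOp d) (yop : ℤ → BdOp d) : Prop :=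
  (∀ k l : ℤ, |k| ≤ (d : ℤ) → |l| ≤ (d : ℤ) → ∀ n : Fin d → ℕ,
    xop k l (e2 d n) = (xCoef d α k l n : ℂ) • e2 d (xIdx d k l n)) ∧
  (∀ m : ℤ, ∀ n : Fin d → ℕ, yop m (e2 d n) = (yCoef d α m n : ℂ) • e2 d n)

/-- The auxiliary ∗-algebra `X`: the unital subalgebra of `B(ℓ²(ℕ^d))`
generated by the `x_{kl}` (`k, l = −d, …, d`) and the `y_n` (`n ∈ ℕ₀`). -/
def Xalg (d : ℕ) (xop : ℤ → ℤ → BdOp d) (yop : ℤ → BdOp d) :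
    Subalgebra ℂ (BdOp d) :=
  Algebra.adjoin ℂ
    ({T | ∃ k l : ℤ, |k| ≤ (d : ℤ) ∧ |l| ≤ (d : ℤ) ∧ T = xop k l} ∪
      {T | ∃ m : ℕ, T = yop m})

/-- `Σ²(X)`: finite sums `Σ_i g_i* g_i` with `g_i ∈ X`. -/
def XSumSq (d : ℕ) (X : Subalgebra ℂ (BdOp d)) : Set (BdOp d) :=
  {T | ∃ (m : ℕ) (g : Fin m → BdOp d),
    (∀ i, g i ∈ X) ∧ T = ∑ i, star (g i) * g i}

/-- The operator `x^𝔫 = x₁^{n₁} ⋯ x_d^{n_d}`, where `x_k = x_{k0}`. -/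
def xPowZ (d : ℕ) (xop : ℤ → ℤ → BdOp d) (n : Fin d → ℕ) : BdOp d :=
  (List.ofFn fun k : Fin d => xop ((k : ℕ) + 1 : ℤ) 0 ^ n k).prod

/-- A ∗-representation of `X` on `H`: a unital ℂ-algebra homomorphism into the
bounded operators on `H` respecting adjoints (`π(T*) = π(T)*`). -/
def IsStarRep (d : ℕ) (xop : ℤ → ℤ → BdOp d) (yop : ℤ → BdOp d)
    {H : Type*} [NormedAddCommGroup H] [InnerProductSpace ℂ H] [CompleteSpace H]
    (π : ↥(Xalg d xop yop) →ₐ[ℂ] (H →L[ℂ] H)) : Prop :=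
  ∀ T U : ↥(Xalg d xop yop), (T : BdOp d) = star (U : BdOp d) → π T = star (π U)

/-- The constant `c_𝔫 = (n₁!⋯n_d!)^{-1/2} (1+α)⋯(|𝔫|+α)` (with `c₀ = 1`). -/
def cIdx (d : ℕ) (α : ℝ) (n : Fin d → ℕ) : ℝ :=
  (Real.sqrt ((∏ i, Nat.factorial (n i) : ℕ) : ℝ))⁻¹ *
    ∏ j ∈ Finset.range (degIdx d n), ((j : ℝ) + 1 + α)

section BasisAction

variable {d : ℕ}

lemma inner_e2_left (n : Fin d → ℕ) (f : L2 d) : inner ℂ (e2 d n) f = f n := by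
  simp [e2, lp.inner_single_left]

lemma e2_apply (n m : Fin d → ℕ) : e2 d n m = if m = n then 1 else 0 := by
  simp [e2, lp.single_apply, Pi.single_apply]

lemma inner_e2_e2 (n m : Fin d → ℕ) : inner ℂ (e2 d n) (e2 d m) = if n = m then (1 : ℂ) else 0 := by
  rw [inner_e2_left, e2_apply]

lemma ext_e2 {F : Type*} [NormedAddCommGroup F] [NormedSpace ℂ F] {A B : L2 d →L[ℂ] F}
    (h : ∀ n, A (e2 d n) = B (e2 d n)) : A = B := by
  refine lp.ext_continuousLinearMap (by simp) fun n => ?_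
  ext
  simpa [e2] using h n

lemma ext_inner_e2 {v w : L2 d} (h : ∀ n, inner ℂ (e2 d n) v = inner ℂ (e2 d n) w) : v = w := by
  ext n
  simpa [inner_e2_left] using h n

lemma degIdx_zero : degIdx d 0 = 0 := by simp [degIdx]

lemma degIdx_add_single (n : Fin d → ℕ) (i : Fin d) :
    degIdx d (n + Pi.single i 1) = degIdx d n + 1 := by
  simp [degIdx, Finset.sum_add_distrib]

lemma sub_single_add_single {n : Fin d → ℕ} {i : Fin d} (h : n i ≠ 0) :
    n - Pi.single i 1 + Pi.single i 1 = n := by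
  refine tsub_add_cancel_of_le fun j => ?_
  rcases eq_or_ne j i with rfl | hj
  · simpa using Nat.one_le_iff_ne_zero.2 h
  · simp [hj]

lemma degIdx_sub_single {n : Fin d → ℕ} {i : Fin d} (h : n i ≠ 0) :
    degIdx d (n - Pi.single i 1) + 1 = degIdx d n := by
  rw [← degIdx_add_single, sub_single_add_single h]

lemma multiIndex_induction {p : (Fin d → ℕ) → Prop} (zero : p 0)
    (add_single : ∀ n i, p n → p (n + Pi.single i 1)) (n : Fin d → ℕ) : p n := by
  induction hN : degIdx d n generalizing n with
  | zero =>
    have : n = 0 := by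
      ext i
      simpa [degIdx] using (Finset.sum_eq_zero_iff.1 hN) i (Finset.mem_univ i)
    exact this ▸ zero
  | succ N ih =>
    obtain ⟨i, -, hi⟩ := Finset.exists_ne_zero_of_sum_ne_zero (hN.trans_ne N.succ_ne_zero)
    rw [← sub_single_add_single hi]
    exact add_single _ _ (ih _ (by have := degIdx_sub_single hi; omega))

lemma eq_zero_or_eq_pos_or_eq_neg {k : ℤ} (hk : |k| ≤ (d : ℤ)) :
    k = 0 ∨ (∃ i : Fin d, k = (i : ℕ) + 1) ∨ ∃ i : Fin d, k = -((i : ℕ) + 1) := by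
  rw [abs_le] at hk
  rcases lt_trichotomy k 0 with h | h | h
  · exact .inr (.inr ⟨⟨(-k - 1).toNat, by omega⟩, by simp; omega⟩)
  · exact .inl h
  · exact .inr (.inl ⟨⟨(k - 1).toNat, by omega⟩, by simp; omega⟩)

lemma abs_pos_le (i : Fin d) : |((i : ℕ) + 1 : ℤ)| ≤ (d : ℤ) := by
  rw [abs_of_nonneg (by positivity)]
  omega

lemma abs_neg_le (i : Fin d) : |(-((i : ℕ) + 1) : ℤ)| ≤ (d : ℤ) := by
  rw [abs_neg]
  exact abs_pos_le i

lemma aIdx_zero (n : Fin d → ℕ) : aIdx d 0 n = n := by simp [aIdx]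

lemma aCoef_zero (n : Fin d → ℕ) : aCoef d 0 n = 1 := by simp [aCoef]

lemma aIdx_pos (i : Fin d) (n : Fin d → ℕ) :
    aIdx d ((i : ℕ) + 1) n = n - Pi.single i 1 := by
  rw [aIdx, dif_pos (by omega)]
  ext j
  rcases eq_or_ne j i with rfl | hj
  · simp
  · simp [hj]

lemma aCoef_pos (i : Fin d) (n : Fin d → ℕ) : aCoef d ((i : ℕ) + 1) n = √(n i) := by
  rw [aCoef, dif_pos (by omega)]
  simp

lemma aIdx_neg (i : Fin d) (n : Fin d → ℕ) :
    aIdx d (-((i : ℕ) + 1)) n = n + Pi.single i 1 := by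
  rw [aIdx, dif_neg (by omega), dif_pos (by omega)]
  ext j
  rcases eq_or_ne j i with rfl | hj
  · simp
  · simp [hj]

lemma aCoef_neg (i : Fin d) (n : Fin d → ℕ) : aCoef d (-((i : ℕ) + 1)) n = √(n i + 1) := by
  rw [aCoef, dif_neg (by omega), dif_pos (by omega)]
  simp

variable {α : ℝ} {xop : ℤ → ℤ → BdOp d} {yop : ℤ → BdOp d}

lemma yop_apply (hxy : IsXYSystem d α xop yop) (m : ℕ) (n : Fin d → ℕ) :
    yop m (e2 d n) = ((degIdx d n + α + m : ℝ)⁻¹ : ℂ) • e2 d n := by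
  simpa [yCoef] using hxy.2 m n

lemma yop_zero_apply (hxy : IsXYSystem d α xop yop) (n : Fin d → ℕ) :
    yop 0 (e2 d n) = ((degIdx d n + α : ℝ)⁻¹ : ℂ) • e2 d n := by
  simpa using yop_apply hxy 0 n

lemma yop_one_apply (hxy : IsXYSystem d α xop yop) (n : Fin d → ℕ) :
    yop 1 (e2 d n) = ((degIdx d n + α + 1 : ℝ)⁻¹ : ℂ) • e2 d n := by
  simpa using yop_apply hxy 1 n

lemma annihilation_apply (hxy : IsXYSystem d α xop yop) (i : Fin d) (n : Fin d → ℕ) :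
    xop ((i : ℕ) + 1) 0 (e2 d n) =
      ((√(n i) / (degIdx d n + α) : ℝ) : ℂ) • e2 d (n - Pi.single i 1) := by
  rw [hxy.1 _ 0 (abs_pos_le i) (by simp) n, xCoef, if_pos (by simp), xIdx]
  simp only [aIdx_zero, aIdx_pos, aCoef_zero, aCoef_pos, mul_one]

lemma star_annihilation_apply (hxy : IsXYSystem d α xop yop) (i : Fin d) (n : Fin d → ℕ) :
    star (xop ((i : ℕ) + 1) 0) (e2 d n) =
      ((√(n i + 1) / (degIdx d n + α + 1) : ℝ) : ℂ) • e2 d (n + Pi.single i 1) := by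
  refine ext_inner_e2 fun j => ?_
  rw [ContinuousLinearMap.star_eq_adjoint, ContinuousLinearMap.adjoint_inner_right,
    annihilation_apply hxy, inner_smul_left, inner_smul_right, inner_e2_e2, inner_e2_e2,
    Complex.conj_ofReal]
  by_cases hj : j i = 0
  · have : j ≠ n + Pi.single i 1 := by
      rintro rfl
      simp at hj
    simp [hj, this]
  · have hiff : j - Pi.single i 1 = n ↔ j = n + Pi.single i 1 := by
      constructor
      · rintro rfl
        exact (sub_single_add_single hj).symm
      · rintro rfl
        simp
    simp only [hiff]
    split_ifs with h
    · subst h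
      simp [degIdx_add_single]
      ring
    · simp

lemma commute_annihilation (hxy : IsXYSystem d α xop yop) (i j : Fin d) :
    Commute (xop ((i : ℕ) + 1) 0) (xop ((j : ℕ) + 1) 0) := by
  rcases eq_or_ne i j with rfl | hij
  · exact Commute.refl _
  refine ext_e2 fun n => ?_
  simp only [mul_apply_eq_comp, annihilation_apply hxy, map_smul, smul_smul]
  by_cases hi : n i = 0
  · simp [hi, hij]
  by_cases hj : n j = 0
  · simp [hj, hij.symm]
  have h1 := degIdx_sub_single hi
  have h2 := degIdx_sub_single hj
  have h3 : degIdx d (n - Pi.single i 1) = degIdx d (n - Pi.single j 1) := by omega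
  simp only [Pi.sub_apply, Pi.single_apply, hij, hij.symm, if_false, tsub_zero, h3,
    tsub_right_comm (a := n) (b := Pi.single i 1)]
  congr 1
  push_cast
  ring

/-- The resolvent identity between `y₀` and `y_m`. -/
lemma yop_zero_eq (hxy : IsXYSystem d α xop yop) (hα : 0 < α) (m : ℕ) :
    yop 0 = yop m + (m : ℂ) • (yop m * yop 0) := by
  refine ext_e2 fun n => ?_
  simp only [mul_apply_eq_comp, yop_apply hxy, yop_zero_apply hxy, map_smul, smul_smul,
    add_apply, smul_apply, ← add_smul]
  congr 1
  norm_cast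
  have : (degIdx d n + α : ℝ) ≠ 0 := by positivity
  have : (degIdx d n + α + m : ℝ) ≠ 0 := by positivity
  field_simp

lemma yop_mul_star_annihilation (hxy : IsXYSystem d α xop yop) (i : Fin d) (m : ℕ) :
    yop m * star (xop ((i : ℕ) + 1) 0) = star (xop ((i : ℕ) + 1) 0) * yop ((m + 1 : ℕ) : ℤ) := by
  refine ext_e2 fun n => ?_
  simp only [mul_apply_eq_comp, yop_apply hxy, star_annihilation_apply hxy, map_smul,
    smul_smul, degIdx_add_single]
  congr 1
  push_cast
  ring_nf

/-- The identity `y₀ = α y₀² + ∑ x_k* x_k`. -/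
lemma yop_zero_eq_sum (hxy : IsXYSystem d α xop yop) (hα : 0 < α) :
    yop 0 = (α : ℂ) • (yop 0 * yop 0) +
      ∑ i : Fin d, star (xop ((i : ℕ) + 1) 0) * xop ((i : ℕ) + 1) 0 := by
  refine ext_e2 fun n => ?_
  have key (i : Fin d) : (star (xop ((i : ℕ) + 1) 0) * xop ((i : ℕ) + 1) 0) (e2 d n) =
      ((n i / (degIdx d n + α) ^ 2 : ℝ) : ℂ) • e2 d n := by
    rw [mul_apply_eq_comp, annihilation_apply hxy, map_smul,
      star_annihilation_apply hxy, smul_smul]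
    by_cases hi : n i = 0
    · simp [hi]
    have h1 : ((n - Pi.single i 1 : Fin d → ℕ) i : ℝ) + 1 = n i := by
      rw [Pi.sub_apply, Pi.single_eq_same]
      exact_mod_cast Nat.sub_add_cancel (Nat.one_le_iff_ne_zero.2 hi)
    have h2 : (degIdx d (n - Pi.single i 1) : ℝ) + α + 1 = degIdx d n + α := by
      rw [← degIdx_sub_single hi]
      push_cast
      ring
    rw [sub_single_add_single hi, h1, h2, ← Complex.ofReal_mul, div_mul_div_comm,
      Real.mul_self_sqrt (by positivity), sq]
  simp only [add_apply, sum_apply, key,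
    ← Finset.sum_smul, smul_apply, mul_apply_eq_comp,
    yop_zero_apply hxy, map_smul, smul_smul, ← add_smul]
  congr 1
  rw [← Complex.ofReal_sum, ← Finset.sum_div]
  have hs : (∑ i, (n i : ℝ)) = degIdx d n := by simp [degIdx]
  rw [hs]
  norm_cast
  have : (degIdx d n + α : ℝ) ≠ 0 := by positivity
  field_simp
  ring

lemma one_sub_yop_one_apply (hxy : IsXYSystem d α xop yop) (hα : 0 < α) (n : Fin d → ℕ) :
    (1 - yop 1) (e2 d n) =
      (((degIdx d n + α) / (degIdx d n + α + 1) : ℝ) : ℂ) • e2 d n := by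
  rw [sub_apply, one_apply_eq_self, yop_one_apply hxy, ← one_smul ℂ (e2 d n), smul_smul, ← sub_smul,
    one_smul]
  congr 1
  norm_cast
  have : (degIdx d n + α + 1 : ℝ) ≠ 0 := by positivity
  field_simp
  ring

/-- Normal ordering: `x_i x_j* = δ_{ij} y₁² + (1 - y₁)² x_j* x_i`. -/
lemma annihilation_mul_star (hxy : IsXYSystem d α xop yop) (hα : 0 < α) (i j : Fin d) :
    xop ((i : ℕ) + 1) 0 * star (xop ((j : ℕ) + 1) 0) =
      (if i = j then (1 : ℂ) else 0) • (yop 1 * yop 1) +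
        (1 - yop 1) * (1 - yop 1) * (star (xop ((j : ℕ) + 1) 0) * xop ((i : ℕ) + 1) 0) := by
  refine ext_e2 fun n => ?_
  have hD : (degIdx d n + α : ℝ) ≠ 0 := by positivity
  have hD1 : (degIdx d n + α + 1 : ℝ) ≠ 0 := by positivity
  have hsx : ((1 - yop 1) * (1 - yop 1) * (star (xop ((j : ℕ) + 1) 0) * xop ((i : ℕ) + 1) 0))
      (e2 d n) = ((√(n i) * √((n - Pi.single i 1 : Fin d → ℕ) j + 1) /
        (degIdx d n + α + 1) ^ 2 : ℝ) : ℂ) • e2 d (n + Pi.single j 1 - Pi.single i 1) := by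
    by_cases hi : n i = 0
    · simp [hi, mul_apply_eq_comp, annihilation_apply hxy]
    have hidx : n + Pi.single j 1 - Pi.single i 1 = n - Pi.single i 1 + Pi.single j 1 := by
      refine (tsub_add_eq_add_tsub ?_).symm
      intro k
      rcases eq_or_ne k i with rfl | hk
      · simpa using Nat.one_le_iff_ne_zero.2 hi
      · simp [hk]
    have hdeg : (degIdx d (n - Pi.single i 1) : ℝ) + α + 1 = degIdx d n + α := by
      rw [← degIdx_sub_single hi]
      push_cast
      ring
    simp only [mul_apply_eq_comp, annihilation_apply hxy, star_annihilation_apply hxy, map_smul,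
      smul_smul, one_sub_yop_one_apply hxy hα, hidx, degIdx_sub_single hi, degIdx_add_single, hdeg]
    congr 1
    norm_cast
    push_cast
    field_simp
  rw [add_apply, hsx]
  simp only [mul_apply_eq_comp, smul_apply, annihilation_apply hxy, star_annihilation_apply hxy,
    yop_one_apply hxy, map_smul, smul_smul, degIdx_add_single]
  rcases eq_or_ne i j with rfl | hij
  · rw [if_pos rfl, add_tsub_cancel_right, ← add_smul]
    congr 1
    norm_cast
    have hsq : √(n i) * √((n - Pi.single i 1 : Fin d → ℕ) i + 1) = n i := by
      by_cases hi : n i = 0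
      · simp [hi]
      have h1 : ((n - Pi.single i 1 : Fin d → ℕ) i : ℝ) + 1 = n i := by
        rw [Pi.sub_apply, Pi.single_eq_same]
        exact_mod_cast Nat.sub_add_cancel (Nat.one_le_iff_ne_zero.2 hi)
      rw [h1, Real.mul_self_sqrt (by positivity)]
    push_cast at hsq ⊢
    rw [hsq, Pi.add_apply, Pi.single_eq_same]
    have h3 : √((n i : ℝ) + 1) ^ 2 = n i + 1 := Real.sq_sqrt (by positivity)
    rw [show (degIdx d n : ℝ) + 1 + α = degIdx d n + α + 1 by ring]
    push_cast
    field_simp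
    linarith
  · rw [if_neg hij, zero_mul, zero_smul, zero_add]
    congr 1
    norm_cast
    simp only [Pi.add_apply, Pi.sub_apply, Pi.single_apply, hij, hij.symm, if_false, add_zero,
      tsub_zero]
    push_cast
    rw [show (degIdx d n : ℝ) + 1 + α = degIdx d n + α + 1 by ring]
    field_simp

lemma xop_zero_right_apply (hxy : IsXYSystem d α xop yop) {k : ℤ} (hk : |k| ≤ (d : ℤ))
    (n : Fin d → ℕ) :
    xop k 0 (e2 d n) = ((aCoef d k n / (degIdx d n + α) : ℝ) : ℂ) • e2 d (aIdx d k n) := by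
  rw [hxy.1 k 0 hk (by simp) n, xCoef, if_pos (by simp), xIdx]
  simp only [aIdx_zero, aCoef_zero, mul_one]

lemma xop_zero_zero (hxy : IsXYSystem d α xop yop) : xop 0 0 = yop 0 := by
  refine ext_e2 fun n => ?_
  rw [xop_zero_right_apply hxy (by simp), yop_zero_apply hxy, aCoef_zero, aIdx_zero]
  simp

lemma star_annihilation_eq (hxy : IsXYSystem d α xop yop) (hα : 0 < α) (i : Fin d) :
    star (xop ((i : ℕ) + 1) 0) = xop (-((i : ℕ) + 1)) 0 * (1 - yop 1) := by
  refine ext_e2 fun n => ?_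
  rw [mul_apply_eq_comp, one_sub_yop_one_apply hxy hα, map_smul, star_annihilation_apply hxy,
    xop_zero_right_apply hxy (abs_neg_le i), smul_smul, aIdx_neg, aCoef_neg]
  congr 1
  norm_cast
  have : (degIdx d n + α : ℝ) ≠ 0 := by positivity
  have : (degIdx d n + α + 1 : ℝ) ≠ 0 := by positivity
  field_simp

lemma creation_eq (hxy : IsXYSystem d α xop yop) (hα : 0 < α) (i : Fin d) :
    xop (-((i : ℕ) + 1)) 0 = star (xop ((i : ℕ) + 1) 0) * (1 + yop 0) := by
  refine ext_e2 fun n => ?_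
  rw [mul_apply_eq_comp, add_apply, one_apply_eq_self, yop_zero_apply hxy, map_add, map_smul,
    star_annihilation_apply hxy, xop_zero_right_apply hxy (abs_neg_le i), smul_smul, ← add_smul,
    aIdx_neg, aCoef_neg]
  congr 1
  norm_cast
  have : (degIdx d n + α : ℝ) ≠ 0 := by positivity
  have : (degIdx d n + α + 1 : ℝ) ≠ 0 := by positivity
  field_simp

lemma xop_pos_right_mul (hxy : IsXYSystem d α xop yop) (hα : 0 < α) {k : ℤ}
    (hk : |k| ≤ (d : ℤ)) (j : Fin d) :
    xop k ((j : ℕ) + 1) * yop 0 = xop k 0 * xop ((j : ℕ) + 1) 0 * (1 - yop 0) := by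
  refine ext_e2 fun n => ?_
  simp only [mul_apply_eq_comp, sub_apply, one_apply_eq_self, yop_zero_apply hxy, map_smul, map_sub,
    xop_zero_right_apply hxy hk, xop_zero_right_apply hxy (abs_pos_le j), smul_smul, ← sub_smul,
    hxy.1 k _ hk (abs_pos_le j), xIdx, xCoef]
  rw [if_pos (.inr (by positivity))]
  rw [aCoef_pos, aIdx_pos]
  congr 1
  norm_cast
  by_cases hj : n j = 0
  · simp [hj]
  have hdeg : (degIdx d n : ℝ) = degIdx d (n - Pi.single j 1) + 1 := by
    exact_mod_cast (degIdx_sub_single hj).symm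
  rw [hdeg]
  have : (degIdx d (n - Pi.single j 1) + α : ℝ) ≠ 0 := by positivity
  have : (degIdx d (n - Pi.single j 1) + 1 + α : ℝ) ≠ 0 := by positivity
  field_simp
  ring

lemma xop_nonneg_neg_mul (hxy : IsXYSystem d α xop yop) {k : ℤ}
    (hk : |k| ≤ (d : ℤ)) (hk0 : 0 ≤ k) (j : Fin d) :
    xop k (-((j : ℕ) + 1)) * yop 1 = xop k 0 * xop (-((j : ℕ) + 1)) 0 := by
  refine ext_e2 fun n => ?_
  simp only [mul_apply_eq_comp, yop_one_apply hxy, map_smul, xop_zero_right_apply hxy hk,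
    xop_zero_right_apply hxy (abs_neg_le j), smul_smul, hxy.1 k _ hk (abs_neg_le j), xIdx, xCoef]
  rw [if_pos (.inl hk0)]
  rw [aIdx_neg, degIdx_add_single]
  congr 1
  norm_cast
  push_cast
  rw [show (degIdx d n : ℝ) + 1 + α = degIdx d n + α + 1 by ring]
  field_simp

lemma xop_neg_neg_mul (hxy : IsXYSystem d α xop yop) (hα : 0 < α) (i j : Fin d) :
    xop (-((i : ℕ) + 1)) (-((j : ℕ) + 1)) * (yop 0 * yop 1) =
      xop (-((i : ℕ) + 1)) 0 * xop (-((j : ℕ) + 1)) 0 * yop 2 := by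
  refine ext_e2 fun n => ?_
  have h2 : yop 2 (e2 d n) = ((degIdx d n + α + 2 : ℝ)⁻¹ : ℂ) • e2 d n := by
    simpa using yop_apply hxy 2 n
  simp only [mul_apply_eq_comp, yop_zero_apply hxy, yop_one_apply hxy, h2, map_smul,
    xop_zero_right_apply hxy (abs_neg_le i), xop_zero_right_apply hxy (abs_neg_le j), smul_smul,
    hxy.1 _ _ (abs_neg_le i) (abs_neg_le j), xIdx, xCoef]
  rw [if_neg (by omega)]
  simp only [aIdx_neg, degIdx_add_single]
  congr 1
  norm_cast
  push_cast
  have : (degIdx d n + α : ℝ) ≠ 0 := by positivity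
  have : (degIdx d n + α + 1 : ℝ) ≠ 0 := by positivity
  have : (degIdx d n + α + 2 : ℝ) ≠ 0 := by positivity
  rw [show (degIdx d n : ℝ) + 1 + α = degIdx d n + α + 1 by ring,
    show (degIdx d n : ℝ) + 1 + 1 + α = degIdx d n + α + 2 by ring]
  field_simp

lemma List.prod_ofFn_pow_add_single {M : Type*} [Monoid M] {d : ℕ} (g : Fin d → M)
    (hg : ∀ i j, Commute (g i) (g j)) (n : Fin d → ℕ) (k : Fin d) :
    (List.ofFn fun i => g i ^ (n + Pi.single k 1 : Fin d → ℕ) i).prod =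
      (List.ofFn fun i => g i ^ n i).prod * g k := by
  induction d with
  | zero => exact k.elim0
  | succ d ih =>
    simp only [List.ofFn_succ, List.prod_cons]
    refine Fin.cases ?_ (fun k => ?_) k
    · have hcomm : Commute (g 0) (List.ofFn fun i : Fin d => g i.succ ^ n i.succ).prod := by
        refine Commute.list_prod_right _ _ fun x hx => ?_
        obtain ⟨i, rfl⟩ := (List.mem_ofFn' _ _).1 hx
        exact (hg 0 i.succ).pow_right _
      simp only [Pi.add_apply, Pi.single_eq_same, pow_succ, ne_eq, Fin.succ_ne_zero,
        not_false_eq_true, Pi.single_eq_of_ne, add_zero, mul_assoc, hcomm.eq]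
    · have := ih (fun i => g i.succ) (fun i j => hg _ _) (fun i => n i.succ) k
      simp only [Pi.add_apply, Pi.single_apply, Fin.succ_inj, (Fin.succ_ne_zero k).symm, if_false,
        add_zero] at this ⊢
      rw [this, mul_assoc]

lemma xPowZ_zero : xPowZ d xop 0 = 1 := by simp [xPowZ]

lemma star_xPowZ_add_single (hxy : IsXYSystem d α xop yop) (n : Fin d → ℕ) (k : Fin d) :
    star (xPowZ d xop (n + Pi.single k 1)) =
      star (xop ((k : ℕ) + 1) 0) * star (xPowZ d xop n) := by
  rw [← star_mul, xPowZ,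
    List.prod_ofFn_pow_add_single (fun k : Fin d => xop ((k : ℕ) + 1) 0)
      (commute_annihilation hxy) n k, xPowZ]

lemma cIdx_zero : cIdx d α 0 = 1 := by simp [cIdx, degIdx_zero]

lemma cIdx_add_single (n : Fin d → ℕ) (k : Fin d) :
    cIdx d α (n + Pi.single k 1) = (degIdx d n + α + 1) / √(n k + 1) * cIdx d α n := by
  have hfac : (∏ i, Nat.factorial ((n + Pi.single k 1 : Fin d → ℕ) i)) =
      (n k + 1) * ∏ i, Nat.factorial (n i) := by
    rw [← Finset.mul_prod_erase _ _ (Finset.mem_univ k),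
      ← Finset.mul_prod_erase _ (fun i => Nat.factorial (n i)) (Finset.mem_univ k), ← mul_assoc,
      ← Nat.factorial_succ]
    congr 1
    · simp
    · refine Finset.prod_congr rfl fun i hi => ?_
      simp [Finset.ne_of_mem_erase hi]
  rw [cIdx, cIdx, degIdx_add_single, Finset.prod_range_succ, hfac, Nat.cast_mul,
    Real.sqrt_mul (by positivity), mul_inv]
  push_cast
  ring

lemma e2_add_single (hxy : IsXYSystem d α xop yop) (hα : 0 < α) (n : Fin d → ℕ) (k : Fin d) :
    e2 d (n + Pi.single k 1) = (((degIdx d n + α + 1) / √(n k + 1) : ℝ) : ℂ) •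
      star (xop ((k : ℕ) + 1) 0) (e2 d n) := by
  rw [star_annihilation_apply hxy, smul_smul, ← Complex.ofReal_mul]
  have h1 : (degIdx d n + α + 1 : ℝ) ≠ 0 := by positivity
  have h2 : √((n k : ℝ) + 1) ≠ 0 := by positivity
  rw [div_mul_div_cancel₀ h2, div_self h1, Complex.ofReal_one, one_smul]

lemma e2_eq_star_xPowZ_apply (hxy : IsXYSystem d α xop yop) (hα : 0 < α) (n : Fin d → ℕ) :
    e2 d n = (cIdx d α n : ℂ) • star (xPowZ d xop n) (e2 d 0) := by
  induction n using multiIndex_induction with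
  | zero => simp [cIdx_zero, xPowZ_zero]
  | add_single n k ih =>
    rw [e2_add_single hxy hα, star_xPowZ_add_single hxy, cIdx_add_single, mul_apply_eq_comp,
      Complex.ofReal_mul, mul_smul, ← map_smul (star (xop ((k : ℕ) + 1) 0)) (cIdx d α n : ℂ), ← ih]

end BasisAction

section Representation

variable {d : ℕ} {α : ℝ} {xop : ℤ → ℤ → BdOp d} {yop : ℤ → BdOp d}

lemma xop_mem {k l : ℤ} (hk : |k| ≤ (d : ℤ)) (hl : |l| ≤ (d : ℤ)) : xop k l ∈ Xalg d xop yop :=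
  Algebra.subset_adjoin (.inl ⟨k, l, hk, hl, rfl⟩)

lemma yop_mem (m : ℕ) : yop m ∈ Xalg d xop yop :=
  Algebra.subset_adjoin (.inr ⟨m, rfl⟩)

lemma star_annihilation_mem (hxy : IsXYSystem d α xop yop) (hα : 0 < α) (i : Fin d) :
    star (xop ((i : ℕ) + 1) 0) ∈ Xalg d xop yop := by
  rw [star_annihilation_eq hxy hα]
  exact mul_mem (xop_mem (abs_neg_le i) (by simp)) (sub_mem (one_mem _) (yop_mem 1))

lemma xPowZ_mem (n : Fin d → ℕ) : xPowZ d xop n ∈ Xalg d xop yop := by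
  refine list_prod_mem fun T hT => ?_
  obtain ⟨i, rfl⟩ := (List.mem_ofFn' _ _).1 hT
  exact pow_mem (xop_mem (abs_pos_le i) (by simp)) _

/-- The element `x_i` of `X`. -/
def annihilationX (xop : ℤ → ℤ → BdOp d) (yop : ℤ → BdOp d) (i : Fin d) : Xalg d xop yop :=
  ⟨xop ((i : ℕ) + 1) 0, xop_mem (abs_pos_le i) (by simp)⟩

/-- The element `x_i*` of `X`. -/
def starAnnihilationX (hxy : IsXYSystem d α xop yop) (hα : 0 < α) (i : Fin d) : Xalg d xop yop :=
  ⟨star (xop ((i : ℕ) + 1) 0), star_annihilation_mem hxy hα i⟩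

/-- The element `y_m` of `X`. -/
def resolventX (xop : ℤ → ℤ → BdOp d) (yop : ℤ → BdOp d) (m : ℕ) : Xalg d xop yop :=
  ⟨yop m, yop_mem m⟩

variable {H : Type*} [NormedAddCommGroup H] [InnerProductSpace ℂ H]

/-- The elements of `X` whose joint action on `ℓ²(ℕ^d) × H` preserves the subspace `G`. -/
def pairStabilizer (π : Xalg d xop yop →ₐ[ℂ] (H →L[ℂ] H)) (G : Submodule ℂ (L2 d × H)) :
    Subalgebra ℂ (Xalg d xop yop) where
  carrier := {T | ∀ p ∈ G, ((T : BdOp d) p.1, π T p.2) ∈ G}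
  mul_mem' {S T} hS hT p hp := by simpa using hS _ (hT p hp)
  add_mem' {S T} hS hT p hp := by simpa using G.add_mem (hS p hp) (hT p hp)
  algebraMap_mem' r p hp := by
    simpa [Algebra.algebraMap_eq_smul_one, ← Prod.smul_mk] using G.smul_mem r hp

/-- The span in `ℓ²(ℕ^d) × H` of the pairs `(e_𝔫, f_𝔫)`. -/
def pairSpan (f : (Fin d → ℕ) → H) : Submodule ℂ (L2 d × H) :=
  Submodule.span ℂ (Set.range fun n => (e2 d n, f n))

lemma mem_pairSpan (f : (Fin d → ℕ) → H) (n : Fin d → ℕ) : (e2 d n, f n) ∈ pairSpan f :=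
  Submodule.subset_span ⟨n, rfl⟩

lemma mem_pairStabilizer_pairSpan {π : Xalg d xop yop →ₐ[ℂ] (H →L[ℂ] H)}
    {f : (Fin d → ℕ) → H} {T : Xalg d xop yop}
    (h : ∀ n, ((T : BdOp d) (e2 d n), π T (f n)) ∈ pairSpan f) :
    T ∈ pairStabilizer π (pairSpan f) := by
  intro p hp
  induction hp using Submodule.span_induction with
  | mem p hp =>
    obtain ⟨n, rfl⟩ := hp
    exact h n
  | zero =>
    rw [Prod.fst_zero, Prod.snd_zero, map_zero, map_zero]
    exact zero_mem _
  | add p q _ _ hp hq => simpa using add_mem hp hq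
  | smul c p _ hp => simpa using Submodule.smul_mem _ c hp

/-- An operator lies in the stabilizer as soon as its product with an operator acting by
nonzero scalars on all pairs `(e_𝔫, f_𝔫)` does. -/
lemma mem_pairStabilizer_of_mul {π : Xalg d xop yop →ₐ[ℂ] (H →L[ℂ] H)}
    {f : (Fin d → ℕ) → H} {T Y : Xalg d xop yop} {c : (Fin d → ℕ) → ℂ} (hc : ∀ n, c n ≠ 0)
    (hYe : ∀ n, (Y : BdOp d) (e2 d n) = c n • e2 d n) (hYf : ∀ n, π Y (f n) = c n • f n)
    (h : T * Y ∈ pairStabilizer π (pairSpan f)) : T ∈ pairStabilizer π (pairSpan f) := by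
  refine mem_pairStabilizer_pairSpan fun n => ?_
  have := Submodule.smul_mem _ (c n)⁻¹ (h _ (mem_pairSpan f n))
  simpa [hYe, hYf, smul_smul, hc n] using this

/-- The vectors `c_𝔫 π((x^𝔫)*)φ`. -/
def ladder (α : ℝ) (π : Xalg d xop yop →ₐ[ℂ] (H →L[ℂ] H))
    (xs : (Fin d → ℕ) → Xalg d xop yop) (φ : H) (n : Fin d → ℕ) : H :=
  (cIdx d α n : ℂ) • π (xs n) φ

section Ladder

variable {π : Xalg d xop yop →ₐ[ℂ] (H →L[ℂ] H)} {xs : (Fin d → ℕ) → Xalg d xop yop} {φ : H}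

lemma ladder_zero (hxs : ∀ n, (xs n : BdOp d) = star (xPowZ d xop n)) :
    ladder α π xs φ 0 = φ := by
  have : xs 0 = 1 := Subtype.ext (by simp [hxs, xPowZ_zero])
  simp [ladder, this, cIdx_zero]

lemma ladder_add_single (hxy : IsXYSystem d α xop yop) (hα : 0 < α)
    (hxs : ∀ n, (xs n : BdOp d) = star (xPowZ d xop n)) (n : Fin d → ℕ) (k : Fin d) :
    ladder α π xs φ (n + Pi.single k 1) = (((degIdx d n + α + 1) / √(n k + 1) : ℝ) : ℂ) •
      π (starAnnihilationX hxy hα k) (ladder α π xs φ n) := by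
  have : xs (n + Pi.single k 1) = starAnnihilationX hxy hα k * xs n :=
    Subtype.ext (by simp [hxs, star_xPowZ_add_single hxy, starAnnihilationX])
  rw [ladder, ladder, this, map_mul, mul_apply_eq_comp, map_smul, smul_smul, cIdx_add_single,
    Complex.ofReal_mul]

lemma map_starAnnihilationX_ladder (hxy : IsXYSystem d α xop yop) (hα : 0 < α)
    (hxs : ∀ n, (xs n : BdOp d) = star (xPowZ d xop n)) (n : Fin d → ℕ) (k : Fin d) :
    π (starAnnihilationX hxy hα k) (ladder α π xs φ n) =
      ((√(n k + 1) / (degIdx d n + α + 1) : ℝ) : ℂ) • ladder α π xs φ (n + Pi.single k 1) := by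
  rw [ladder_add_single hxy hα hxs, smul_smul, ← Complex.ofReal_mul]
  have h1 : (degIdx d n + α + 1 : ℝ) ≠ 0 := by positivity
  have h2 : √((n k : ℝ) + 1) ≠ 0 := by positivity
  rw [div_mul_div_cancel₀ h1, div_self h2, Complex.ofReal_one, one_smul]

lemma map_resolventX_vacuum (hxy : IsXYSystem d α xop yop) (hα : 0 < α)
    (hφ : π (resolventX xop yop 0) φ = ((α⁻¹ : ℝ) : ℂ) • φ) (m : ℕ) :
    π (resolventX xop yop m) φ = (((α + m)⁻¹ : ℝ) : ℂ) • φ := by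
  have h : resolventX xop yop 0 =
      resolventX xop yop m + (m : ℂ) • (resolventX xop yop m * resolventX xop yop 0) :=
    Subtype.ext (by simpa [resolventX] using yop_zero_eq hxy hα m)
  have h' := hφ
  rw [h, map_add, map_smul, map_mul, add_apply, smul_apply, mul_apply_eq_comp, hφ, map_smul,
    smul_smul] at h'
  have h2 : (((α + m) / α : ℝ) : ℂ) • π (resolventX xop yop m) φ = ((α⁻¹ : ℝ) : ℂ) • φ := by
    rw [← h', ← one_smul ℂ (π (resolventX xop yop m) φ), smul_smul, smul_smul, ← add_smul]
    congr 1
    norm_cast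
    field_simp
  have h3 : (α + m : ℝ) ≠ 0 := by positivity
  rw [← one_smul ℂ (π (resolventX xop yop m) φ),
    show (1 : ℂ) = ((α / (α + m) : ℝ) : ℂ) * (((α + m) / α : ℝ) : ℂ) by
      rw [← Complex.ofReal_mul, div_mul_div_cancel₀ h3, div_self hα.ne', Complex.ofReal_one],
    mul_smul, h2, smul_smul, ← Complex.ofReal_mul]
  congr 2
  field_simp

lemma map_resolventX_ladder (hxy : IsXYSystem d α xop yop) (hα : 0 < α)
    (hxs : ∀ n, (xs n : BdOp d) = star (xPowZ d xop n))
    (hφ : π (resolventX xop yop 0) φ = ((α⁻¹ : ℝ) : ℂ) • φ) (m : ℕ) (n : Fin d → ℕ) :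
    π (resolventX xop yop m) (ladder α π xs φ n) =
      ((degIdx d n + α + m : ℝ)⁻¹ : ℂ) • ladder α π xs φ n := by
  induction n using multiIndex_induction generalizing m with
  | zero =>
    rw [ladder_zero hxs, map_resolventX_vacuum hxy hα hφ, degIdx_zero]
    simp
  | add_single n k ih =>
    have h : resolventX xop yop m * starAnnihilationX hxy hα k =
        starAnnihilationX hxy hα k * resolventX xop yop (m + 1) :=
      Subtype.ext (yop_mul_star_annihilation hxy k m)
    rw [ladder_add_single hxy hα hxs, map_smul, ← mul_apply_eq_comp, ← map_mul, h, map_mul,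
      mul_apply_eq_comp, ih, map_smul, smul_comm, degIdx_add_single]
    congr 3
    push_cast
    ring

variable [CompleteSpace H]

lemma map_annihilationX_vacuum (hxy : IsXYSystem d α xop yop) (hα : 0 < α)
    (hπ : IsStarRep d xop yop π)
    (hφ : π (resolventX xop yop 0) φ = ((α⁻¹ : ℝ) : ℂ) • φ) (i : Fin d) :
    π (annihilationX xop yop i) φ = 0 := by
  have h : resolventX xop yop 0 = (α : ℂ) • (resolventX xop yop 0 * resolventX xop yop 0) +
      ∑ i, starAnnihilationX hxy hα i * annihilationX xop yop i :=
    Subtype.ext (by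
      simpa [resolventX, starAnnihilationX, annihilationX] using yop_zero_eq_sum hxy hα)
  have hstar (i : Fin d) : π (starAnnihilationX hxy hα i) = star (π (annihilationX xop yop i)) :=
    hπ _ _ rfl
  have hsum : ∑ i, π (starAnnihilationX hxy hα i) (π (annihilationX xop yop i) φ) = 0 := by
    have h' := hφ
    rw [h] at h'
    simp only [map_add, map_smul, map_mul, map_sum, add_apply, smul_apply, mul_apply_eq_comp,
      sum_apply, hφ, smul_smul] at h'
    rwa [← Complex.ofReal_mul, ← Complex.ofReal_mul, mul_inv_cancel_left₀ hα.ne',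
      add_eq_left] at h'
  have hnorm : ∑ i, ‖π (annihilationX xop yop i) φ‖ ^ 2 = 0 := by
    have := congrArg (inner ℂ φ) hsum
    simp only [inner_sum, hstar, ContinuousLinearMap.star_eq_adjoint,
      ContinuousLinearMap.adjoint_inner_right, inner_self_eq_norm_sq_to_K, inner_zero_right] at this
    refine Complex.ofReal_injective ?_
    push_cast
    exact this
  simpa using (Finset.sum_eq_zero_iff_of_nonneg fun _ _ => by positivity).1 hnorm i
    (Finset.mem_univ i)

lemma pairStabilizer_ladder_eq_top (hxy : IsXYSystem d α xop yop) (hα : 0 < α)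
    (hπ : IsStarRep d xop yop π) (hxs : ∀ n, (xs n : BdOp d) = star (xPowZ d xop n))
    (hφ : π (resolventX xop yop 0) φ = ((α⁻¹ : ℝ) : ℂ) • φ) :
    pairStabilizer π (pairSpan (ladder α π xs φ)) = ⊤ := by
  set f := ladder α π xs φ with hf
  set S := pairStabilizer π (pairSpan f)
  have hc (m : ℕ) (n : Fin d → ℕ) : ((degIdx d n + α + m : ℝ)⁻¹ : ℂ) ≠ 0 := by
    have : (degIdx d n + α + m : ℝ) ≠ 0 := by positivity
    exact inv_ne_zero (by exact_mod_cast this)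
  have hYf := map_resolventX_ladder hxy hα hxs hφ
  have hY (m : ℕ) : resolventX xop yop m ∈ S := mem_pairStabilizer_pairSpan fun n => by
    rw [hYf, show ((resolventX xop yop m : Xalg d xop yop) : BdOp d) = yop m from rfl,
      yop_apply hxy, ← Prod.smul_mk]
    exact Submodule.smul_mem _ _ (mem_pairSpan f n)
  have hs (i : Fin d) : starAnnihilationX hxy hα i ∈ S := mem_pairStabilizer_pairSpan fun n => by
    rw [map_starAnnihilationX_ladder hxy hα hxs,
      show (starAnnihilationX hxy hα i : BdOp d) = star (xop ((i : ℕ) + 1) 0) from rfl,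
      star_annihilation_apply hxy, ← Prod.smul_mk]
    exact Submodule.smul_mem _ _ (mem_pairSpan f _)
  have hx (i : Fin d) : annihilationX xop yop i ∈ S := mem_pairStabilizer_pairSpan fun n => by
    induction n using multiIndex_induction with
    | zero =>
      rw [hf, ladder_zero hxs, map_annihilationX_vacuum hxy hα hπ hφ,
        show (annihilationX xop yop i : BdOp d) = xop ((i : ℕ) + 1) 0 from rfl,
        annihilation_apply hxy, Pi.zero_apply, Nat.cast_zero, Real.sqrt_zero, zero_div,
        Complex.ofReal_zero, zero_smul]
      exact zero_mem _
    | add_single n j ih =>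
      have h : annihilationX xop yop i * starAnnihilationX hxy hα j =
          (if i = j then (1 : ℂ) else 0) • (resolventX xop yop 1 * resolventX xop yop 1) +
            (1 - resolventX xop yop 1) * (1 - resolventX xop yop 1) *
              (starAnnihilationX hxy hα j * annihilationX xop yop i) :=
        Subtype.ext (annihilation_mul_star hxy hα i j)
      have h1 := Submodule.add_mem _
        ((S.smul_mem (S.mul_mem (hY 1) (hY 1)) (if i = j then (1 : ℂ) else 0)) _ (mem_pairSpan f n))
        ((S.mul_mem (S.mul_mem (S.sub_mem S.one_mem (hY 1)) (S.sub_mem S.one_mem (hY 1)))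
          (hs j)) _ ih)
      have h2 := Submodule.smul_mem _ (((degIdx d n + α + 1) / √(n j + 1) : ℝ) : ℂ) h1
      rw [e2_add_single hxy hα, hf, ladder_add_single hxy hα hxs, map_smul, map_smul,
        ← Prod.smul_mk, ← mul_apply_eq_comp (π _), ← map_mul, h]
      convert h2 using 2
      refine Prod.ext ?_ ?_
      · exact congrArg (fun T : Xalg d xop yop => (T : BdOp d) (e2 d n)) h
      · simp [mul_apply_eq_comp, hf]
  have hx0 {k : ℤ} (hk : |k| ≤ (d : ℤ)) :
      (⟨xop k 0, xop_mem hk (by simp)⟩ : Xalg d xop yop) ∈ S := by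
    rcases eq_zero_or_eq_pos_or_eq_neg hk with rfl | ⟨i, rfl⟩ | ⟨i, rfl⟩
    · convert hY 0 using 1
      exact Subtype.ext (xop_zero_zero hxy)
    · exact hx i
    · convert S.mul_mem (hs i) (S.add_mem S.one_mem (hY 0)) using 1
      exact Subtype.ext (creation_eq hxy hα i)
  have hxx {k l : ℤ} (hk : |k| ≤ (d : ℤ)) (hl : |l| ≤ (d : ℤ)) :
      (⟨xop k l, xop_mem hk hl⟩ : Xalg d xop yop) ∈ S := by
    rcases eq_zero_or_eq_pos_or_eq_neg hl with rfl | ⟨j, rfl⟩ | ⟨j, rfl⟩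
    · exact hx0 hk
    · refine mem_pairStabilizer_of_mul (hc 0) (yop_apply hxy 0) (hYf 0) ?_
      convert S.mul_mem (S.mul_mem (hx0 hk) (hx0 hl)) (S.sub_mem S.one_mem (hY 0)) using 1
      exact Subtype.ext (xop_pos_right_mul hxy hα hk j)
    · by_cases hk0 : 0 ≤ k
      · refine mem_pairStabilizer_of_mul (hc 1) (yop_apply hxy 1) (hYf 1) ?_
        convert S.mul_mem (hx0 hk) (hx0 hl) using 1
        exact Subtype.ext (xop_nonneg_neg_mul hxy hk hk0 j)
      · rcases eq_zero_or_eq_pos_or_eq_neg hk with rfl | ⟨i, rfl⟩ | ⟨i, rfl⟩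
        · exact absurd le_rfl hk0
        · exact absurd (by positivity) hk0
        · refine mem_pairStabilizer_of_mul (hc 0) (yop_apply hxy 0) (hYf 0)
            (mem_pairStabilizer_of_mul (hc 1) (yop_apply hxy 1) (hYf 1) ?_)
          convert S.mul_mem (S.mul_mem (hx0 hk) (hx0 hl)) (hY 2) using 1
          rw [mul_assoc]
          exact Subtype.ext (xop_neg_neg_mul hxy hα i j)
  refine Algebra.eq_top_iff.2 fun ⟨T, hT⟩ => ?_
  induction hT using Algebra.adjoin_induction with
  | mem T hT =>
    rcases hT with ⟨k, l, hk, hl, rfl⟩ | ⟨m, rfl⟩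
    · exact hxx hk hl
    · exact hY m
  | algebraMap r => exact S.algebraMap_mem r
  | add T U _ _ hT hU => exact S.add_mem hT hU
  | mul T U _ _ hT hU => exact S.mul_mem hT hU

lemma inner_vacuum_ladder (hxy : IsXYSystem d α xop yop) (hα : 0 < α)
    (hπ : IsStarRep d xop yop π) (hxs : ∀ n, (xs n : BdOp d) = star (xPowZ d xop n))
    (hφ : π (resolventX xop yop 0) φ = ((α⁻¹ : ℝ) : ℂ) • φ) (hφ1 : ‖φ‖ = 1) (n : Fin d → ℕ) :
    inner ℂ φ (ladder α π xs φ n) = inner ℂ (e2 d 0) (e2 d n) := by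
  cases n using multiIndex_induction with
  | zero =>
    rw [ladder_zero hxs, inner_e2_e2, if_pos rfl, inner_self_eq_norm_sq_to_K, hφ1]
    simp
  | add_single n k =>
    have hne : 0 ≠ n + Pi.single k 1 := fun h => by simpa using congrFun h k
    have hstar : π (starAnnihilationX hxy hα k) = star (π (annihilationX xop yop k)) := hπ _ _ rfl
    rw [ladder_add_single hxy hα hxs, inner_smul_right, hstar,
      ContinuousLinearMap.star_eq_adjoint, ContinuousLinearMap.adjoint_inner_right,
      map_annihilationX_vacuum hxy hα hπ hφ, inner_zero_left, mul_zero, inner_e2_e2, if_neg hne]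

lemma orthonormal_ladder (hxy : IsXYSystem d α xop yop) (hα : 0 < α)
    (hπ : IsStarRep d xop yop π) (hxs : ∀ n, (xs n : BdOp d) = star (xPowZ d xop n))
    (hφ : π (resolventX xop yop 0) φ = ((α⁻¹ : ℝ) : ℂ) • φ) (hφ1 : ‖φ‖ = 1) :
    Orthonormal ℂ (ladder α π xs φ) := by
  have hpair {p : L2 d × H} (hp : p ∈ pairSpan (ladder α π xs φ)) :
      inner ℂ φ p.2 = inner ℂ (e2 d 0) p.1 := by
    induction hp using Submodule.span_induction with
    | mem p hp =>
      obtain ⟨n, rfl⟩ := hp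
      exact inner_vacuum_ladder hxy hα hπ hxs hφ hφ1 n
    | zero => simp
    | add p q _ _ hp hq => simp [hp, hq]
    | smul c p _ hp => simp [hp]
  refine orthonormal_iff_ite.2 fun m n => ?_
  have hstar : π (xs m) = star (π ⟨xPowZ d xop m, xPowZ_mem m⟩) := hπ _ _ (hxs m)
  have hmem : (⟨xPowZ d xop m, xPowZ_mem m⟩ : Xalg d xop yop) ∈
      pairStabilizer π (pairSpan (ladder α π xs φ)) := by
    simp [pairStabilizer_ladder_eq_top hxy hα hπ hxs hφ]
  rw [← inner_e2_e2 m n, ladder, e2_eq_star_xPowZ_apply hxy hα m, inner_smul_left, inner_smul_left,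
    hstar, ContinuousLinearMap.star_eq_adjoint, ContinuousLinearMap.adjoint_inner_left,
    hpair (hmem _ (mem_pairSpan _ n)), ContinuousLinearMap.star_eq_adjoint,
    ContinuousLinearMap.adjoint_inner_left]

end Ladder

end Representation

/-- Section 4.2: for a unit vector `φ ∈ ker(π(y₀) − α⁻¹ I)`, the map
`e_𝔫 ↦ c_𝔫 π((x^𝔫)*)φ` extends to an isometry `V : ℓ²(ℕ^d) → H`
intertwining the identity representation with `π`; hence the restriction of
`π` to the range of `V` is unitarily equivalent to the identity
representation of `X`. -/
theorem stmt17 (d : ℕ) (hd : 1 ≤ d) (α : ℝ) (hα : 0 < α)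
    (hαint : ∀ z : ℤ, α ≠ (z : ℝ))
    (xop : ℤ → ℤ → BdOp d) (yop : ℤ → BdOp d) (hxy : IsXYSystem d α xop yop)
    {H : Type*} [NormedAddCommGroup H] [InnerProductSpace ℂ H] [CompleteSpace H]
    (π : ↥(Xalg d xop yop) →ₐ[ℂ] (H →L[ℂ] H)) (hπ : IsStarRep d xop yop π)
    (Ty : ↥(Xalg d xop yop)) (hTy : (Ty : BdOp d) = yop 0)
    (xs : (Fin d → ℕ) → ↥(Xalg d xop yop))
    (hxs : ∀ n : Fin d → ℕ, (xs n : BdOp d) = star (xPowZ d xop n))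
    (φ : H) (hφ : π Ty φ = ((α⁻¹ : ℝ) : ℂ) • φ) (hφ1 : ‖φ‖ = 1) :
    ∃ V : L2 d →ₗᵢ[ℂ] H,
      (∀ n : Fin d → ℕ, V (e2 d n) = (cIdx d α n : ℂ) • π (xs n) φ) ∧
      (∀ T : ↥(Xalg d xop yop), ∀ ψ : L2 d, V ((T : BdOp d) ψ) = π T (V ψ)) := by
  have hφ' : π (resolventX xop yop 0) φ = ((α⁻¹ : ℝ) : ℂ) • φ := by
    rw [← hφ]
    congr 2
    exact Subtype.ext hTy.symm
  have hon := orthonormal_ladder hxy hα hπ hxs hφ' hφ1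
  set V : L2 d →ₗᵢ[ℂ] H := hon.orthogonalFamily.linearIsometry
  have hVe (n : Fin d → ℕ) : V (e2 d n) = ladder α π xs φ n := by
    simp [V, e2, OrthogonalFamily.linearIsometry_apply_single]
  refine ⟨V, hVe, fun T => ?_⟩
  have hgraph {p : L2 d × H} (hp : p ∈ pairSpan (ladder α π xs φ)) : V p.1 = p.2 := by
    induction hp using Submodule.span_induction with
    | mem p hp =>
      obtain ⟨n, rfl⟩ := hp
      exact hVe n
    | zero => simp
    | add p q _ _ hp hq => simp [hp, hq]
    | smul c p _ hp => simp [hp]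
  have hT : T ∈ pairStabilizer π (pairSpan (ladder α π xs φ)) := by
    simp [pairStabilizer_ladder_eq_top hxy hα hπ hxs hφ']
  have hcomp : V.toContinuousLinearMap ∘L (T : BdOp d) = π T ∘L V.toContinuousLinearMap :=
    ext_e2 fun n => by simpa [hVe] using hgraph (hT _ (mem_pairSpan _ n))
  exact fun ψ => congrArg (fun A : L2 d →L[ℂ] H => A ψ) hcomp
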